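/- arXiv:1408.1478 — 3 statements merged into one kernel-verified Lean document; each statement's English description precedes it below -/
import Mathlib

section
/- Let n ≥ 1, let V : ℝ × ℝⁿ → ℝ be C^∞ and sub-quadratic with exponent ρ ∈ [0,2). Let u : ℝ × ℝⁿ → ℂ be smooth, with t ↦ u(t,·) a C¹ map from ℝ into the Schwartz space 𝒮(ℝⁿ), satisfying i∂_t u + (1/2)Δu − V(t,x)u = 0 pointwise; set u₀ = u(0,·). Let φ₀ ∈ 𝒮(ℝⁿ), φ^{(t)} = U₀(t)φ₀, F(t,x,ξ) = ∫ conj(φ^{(t)}(y−x)) u(t,y) e^{−i y·ξ} dy, Ṽ(t,x) = V(t,x) − x·∇_x V(t,x), and R(t,x,ξ) = ∫ conj(φ^{(t)}(y−x)) [ V(t,y) − V(t,x) − ∇_x V(t,x)·(y−x) ] u(t,y) e^{−i y·ξ} dy. For (t,x,ξ) ∈ ℝ × ℝⁿ × ℝⁿ, let (x(s; t, x, ξ), ξ(s; t, x, ξ)) be the solution of the Hamilton equations with data (x,ξ) at time t. Then for all (t,x,ξ): F(t,x,ξ) = e^{−i ∫₀^t [ (1/2)|ξ(s; t,x,ξ)|²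 + Ṽ(s, x(s; t,x,ξ)) ] ds} · W_{φ₀} u₀( x(0; t,x,ξ), ξ(0; t,x,ξ) ) − i ∫₀^t e^{−i ∫_s^t [ (1/2)|ξ(s₁; t,x,ξ)|² + Ṽ(s₁, x(s₁; t,x,ξ)) ] ds₁} · R( s, x(s; t,x,ξ), ξ(s; t,x,ξ) ) ds. -/
open MeasureTheory Complex
open scoped InnerProductSpace BigOperators

noncomputable section

/-- `ℝⁿ` as a Euclidean space. -/
abbrev Euc (n : ℕ) := EuclideanSpace ℝ (Fin n)

variable {n : ℕ}

/-- Wave packet transform `W_φ f (x, ξ) = ∫ conj (φ (y - x)) f y e^{-i y·ξ} dy`. -/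
def WPT (φ f : Euc n → ℂ) (x ξ : Euc n) : ℂ :=
  ∫ y, (starRingEnd ℂ) (φ (y - x)) * f y * Complex.exp (-Complex.I * ((⟪y, ξ⟫_ℝ : ℝ) : ℂ))

/-- Fourier transform `f̂(ξ) = ∫ e^{-i y·ξ} f y dy`. -/
def FT (f : Euc n → ℂ) (ξ : Euc n) : ℂ :=
  ∫ y, Complex.exp (-Complex.I * ((⟪y, ξ⟫_ℝ : ℝ) : ℂ)) * f y

/-- Free Schrödinger evolution `U₀(t) f (x) = (2π)^{-n} ∫ e^{i(x·ξ - t|ξ|²/2)} f̂(ξ) dξ`. -/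
def U0 (t : ℝ) (f : Euc n → ℂ) (x : Euc n) : ℂ :=
  (((2 * Real.pi) ^ n)⁻¹ : ℝ) •
    ∫ ξ, Complex.exp (Complex.I * ((⟪x, ξ⟫_ℝ - t * ‖ξ‖ ^ 2 / 2 : ℝ) : ℂ)) * FT f ξ

/-- Dilation `(φ)_λ(x) = λ^{n b / 2} φ (λ^b x)` (with `λ^b` a real power). -/
def dilate (b lam : ℝ) (φ : Euc n → ℂ) : Euc n → ℂ :=
  fun x => ((lam ^ ((n : ℝ) * b / 2) : ℝ) : ℂ) * φ ((lam ^ b : ℝ) • x)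

/-- `V` is smooth and sub-quadratic with exponent `ρ`:
`|∂_x^α V(t,x)| ≤ C_α (1+|x|)^{ρ-|α|}` for all multi-indices `α`. -/
def SubQuadratic (ρ : ℝ) (V : ℝ × Euc n → ℝ) : Prop :=
  ContDiff ℝ (⊤ : ℕ∞) V ∧
    ∀ k : ℕ, ∃ C : ℝ, 0 < C ∧ ∀ (t : ℝ) (x : Euc n),
      ‖iteratedFDeriv ℝ k (fun z => V (t, z)) x‖ ≤ C * (1 + ‖x‖) ^ (ρ - (k : ℝ))

/-- Gradient of `V` in the `x` variable. -/
def gradV (V : ℝ × Euc n → ℝ) (t : ℝ) (x : Euc n) : Euc n :=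
  gradient (fun z => V (t, z)) x

/-- `(X, Ξ)` solves the Hamilton equations `ẋ = ξ`, `ξ̇ = -∇ₓ V`. -/
def IsHamiltonSol (V : ℝ × Euc n → ℝ) (X Ξ : ℝ → Euc n) : Prop :=
  (∀ s, HasDerivAt X (Ξ s) s) ∧ (∀ s, HasDerivAt Ξ (-gradV V s (X s)) s)

/-- `Γ` is a conic neighborhood of `ξ₀`. -/
def IsConicNbhd (Γ : Set (Euc n)) (ξ₀ : Euc n) : Prop :=
  Γ ∈ nhds ξ₀ ∧ ∀ ξ ∈ Γ, ∀ c : ℝ, 0 < c → c • ξ ∈ Γ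

/-- `(x₀, ξ₀)` is not in the wave front set of the (locally integrable) function `f`. -/
def NotInWF (f : Euc n → ℂ) (x₀ ξ₀ : Euc n) : Prop :=
  ∃ χ : Euc n → ℝ, ContDiff ℝ (⊤ : ℕ∞) χ ∧ HasCompactSupport χ ∧ χ x₀ ≠ 0 ∧
    ∃ Γ₀ : Set (Euc n), IsConicNbhd Γ₀ ξ₀ ∧
      ∀ N : ℕ, ∃ C : ℝ, 0 < C ∧ ∀ ξ ∈ Γ₀,
        ‖∫ y, (χ y : ℂ) * f y * Complex.exp (-Complex.I * ((⟪y, ξ⟫_ℝ : ℝ) : ℂ))‖ ≤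
          C * (1 + ‖ξ‖) ^ (-(N : ℝ))

/-- `∂_t Φ` for `Φ : ℝ × ℝⁿ → ℂ`. -/
def tDerivP (Φ : ℝ × Euc n → ℂ) (p : ℝ × Euc n) : ℂ :=
  fderiv ℝ Φ p ((1 : ℝ), (0 : Euc n))

/-- `∂_{x_j} Φ` for `Φ : ℝ × ℝⁿ → ℂ`. -/
def xPartialP (j : Fin n) (Φ : ℝ × Euc n → ℂ) (p : ℝ × Euc n) : ℂ :=
  fderiv ℝ (fun z => Φ (p.1, z)) p.2 (EuclideanSpace.single j 1)

/-- Laplacian in the `x` variable of `Φ : ℝ × ℝⁿ → ℂ`. -/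
def xLaplacianP (Φ : ℝ × Euc n → ℂ) (p : ℝ × Euc n) : ℂ :=
  ∑ j : Fin n, xPartialP j (fun q => xPartialP j Φ q) p

/-- `u` is a distributional solution of `i ∂_t u + (1/2) Δ u - V u = 0`:
`∬ u (−i∂_tΦ + (1/2)ΔΦ − VΦ) dx dt = 0` for every test function `Φ`. -/
def IsDistSol (V : ℝ × Euc n → ℝ) (u : ℝ → Euc n → ℂ) : Prop :=
  ∀ Φ : ℝ × Euc n → ℂ, ContDiff ℝ (⊤ : ℕ∞) Φ → HasCompactSupport Φ →
    (∫ p : ℝ × Euc n, u p.1 p.2 *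
        (-Complex.I * tDerivP Φ p + (1 / 2 : ℂ) * xLaplacianP Φ p - ((V p : ℝ) : ℂ) * Φ p)) = 0

/-- `∂_{y_j} g` for `g : ℝⁿ → ℂ`. -/
def partialD (j : Fin n) (g : Euc n → ℂ) : Euc n → ℂ :=
  fun y => fderiv ℝ g y (EuclideanSpace.single j 1)

/-- Laplacian of `g : ℝⁿ → ℂ`. -/
def lapl (g : Euc n → ℂ) : Euc n → ℂ :=
  fun y => ∑ j : Fin n, partialD j (partialD j g) y

/-- Multi-index derivative `∂^α g`. -/
def multiPartial (α : Fin n → ℕ) (g : Euc n → ℂ) : Euc n → ℂ :=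
  ((List.ofFn fun j : Fin n => (partialD j)^[α j]).foldr (· ∘ ·) id) g

/-- A jointly continuous family of functions on `ℝⁿ`, dominated by an integrable function locally
uniformly in the parameter. -/
def LocallyDominated (A : ℝ → Euc n → ℂ) : Prop :=
  Continuous (Function.uncurry A) ∧
    ∀ T : ℝ, ∃ b : Euc n → ℝ, Integrable b ∧ ∀ s, |s| ≤ T → ∀ y, ‖A s y‖ ≤ b y

namespace LocallyDominated

variable {A B : ℝ → Euc n → ℂ}

theorem add (hA : LocallyDominated A) (hB : LocallyDominated B) :
    LocallyDominated fun s y => A s y + B s y := by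
  refine ⟨hA.1.add hB.1, fun T => ?_⟩
  obtain ⟨a, ha, hAa⟩ := hA.2 T
  obtain ⟨b, hb, hBb⟩ := hB.2 T
  exact ⟨a + b, ha.add hb, fun s hs y =>
    (norm_add_le _ _).trans (add_le_add (hAa s hs y) (hBb s hs y))⟩

theorem const_mul (hA : LocallyDominated A) {a : ℝ → ℂ} (ha : Continuous a) :
    LocallyDominated fun s y => a s * A s y := by
  refine ⟨(ha.comp continuous_fst).mul hA.1, fun T => ?_⟩
  obtain ⟨b, hb, hAb⟩ := hA.2 T
  obtain ⟨C, hC⟩ := (isCompact_Icc (a := -T) (b := T)).exists_bound_of_continuousOn ha.continuousOn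
  refine ⟨fun y => C * b y, hb.const_mul C, fun s hs y => ?_⟩
  have h := hC s (abs_le.1 hs)
  rw [norm_mul]
  exact mul_le_mul h (hAb s hs y) (norm_nonneg _) ((norm_nonneg _).trans h)

theorem sub (hA : LocallyDominated A) (hB : LocallyDominated B) :
    LocallyDominated fun s y => A s y - B s y := by
  convert! hA.add (hB.const_mul (a := fun _ => -1) continuous_const) using 3
  ring

theorem exp_mul (hA : LocallyDominated A) {θ : ℝ → Euc n → ℝ}
    (hθ : Continuous (Function.uncurry θ)) :
    LocallyDominated fun s y => Complex.exp (Complex.I * (θ s y : ℂ)) * A s y := by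
  refine ⟨?_, fun T => ?_⟩
  · have h : Continuous fun p : ℝ × Euc n =>
        Complex.exp (Complex.I * ((Function.uncurry θ p : ℝ) : ℂ)) := by fun_prop
    exact h.mul hA.1
  · obtain ⟨b, hb, hAb⟩ := hA.2 T
    refine ⟨b, hb, fun s hs y => ?_⟩
    rw [norm_mul, mul_comm Complex.I, Complex.norm_exp_ofReal_mul_I, one_mul]
    exact hAb s hs y

theorem integrable (hA : LocallyDominated A) (s : ℝ) : Integrable (A s) := by
  obtain ⟨b, hb, hAb⟩ := hA.2 |s|
  have h : Continuous (A s) := hA.1.comp (Continuous.prodMk_right s)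
  exact hb.mono' h.aestronglyMeasurable (.of_forall (hAb s le_rfl))

/-- The domination on the time interval between `a` and `b`. -/
theorem exists_bound_uIoc (hA : LocallyDominated A) (a b : ℝ) :
    ∃ g : Euc n → ℝ, Integrable g ∧ ∀ s ∈ Set.uIoc a b, ∀ y, ‖A s y‖ ≤ g y := by
  obtain ⟨g, hg, hAg⟩ := hA.2 (max |a| |b|)
  refine ⟨g, hg, fun s hs y => hAg s ?_ y⟩
  rcases Set.mem_uIcc.1 (Set.uIoc_subset_uIcc hs) with h | h
  · exact abs_le_max_abs_abs h.1 h.2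
  · exact max_comm |b| |a| ▸ abs_le_max_abs_abs h.1 h.2

theorem integrable_prod (hA : LocallyDominated A) (a b : ℝ) :
    Integrable (Function.uncurry A) ((volume.restrict (Set.uIoc a b)).prod volume) := by
  obtain ⟨g, hg, hAg⟩ := hA.exists_bound_uIoc a b
  have : IsFiniteMeasure (volume.restrict (Set.uIoc a b)) := by
    rw [Set.uIoc]; infer_instance
  refine (hg.comp_snd (volume.restrict (Set.uIoc a b))).mono' hA.1.aestronglyMeasurable ?_
  have h : ∀ᵐ s ∂(volume.restrict (Set.uIoc a b)), s ∈ Set.uIoc a b :=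
    ae_restrict_mem measurableSet_uIoc
  filter_upwards [Measure.quasiMeasurePreserving_fst.ae h] with p hp
  exact hAg p.1 hp p.2

/-- The fundamental theorem of calculus for a parametric integral. -/
theorem integral_sub_integral (hA : LocallyDominated A) (hB : LocallyDominated B)
    (hAB : ∀ s y, HasDerivAt (fun r => A r y) (B s y) s) (a b : ℝ) :
    (∫ y, A b y) - ∫ y, A a y = ∫ s in a..b, ∫ y, B s y := by
  rw [intervalIntegral_integral_swap (hB.integrable_prod a b),
    ← integral_sub (hA.integrable b) (hA.integrable a)]
  congr 1 with y
  have hc : Continuous fun s => B s y := hB.1.comp (Continuous.prodMk_left y)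
  exact (intervalIntegral.integral_eq_sub_of_hasDerivAt (fun s _ => hAB s y)
    (hc.intervalIntegrable a b)).symm

/-- Exchanging a time integral with an integral against an integrable amplitude. -/
theorem integral_mul_intervalIntegral (hA : LocallyDominated A) {θ : ℝ → Euc n → Euc n → ℝ}
    (hθ : Continuous fun p : (ℝ × Euc n) × Euc n => θ p.1.1 p.1.2 p.2)
    {g : Euc n → ℂ} (hg : Integrable g) (a b : ℝ) :
    ∫ η, g η * ∫ s in a..b, ∫ y, Complex.exp (Complex.I * (θ s η y : ℂ)) * A s y =
      ∫ s in a..b, ∫ η, g η * ∫ y, Complex.exp (Complex.I * (θ s η y : ℂ)) * A s y := by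
  have hm : StronglyMeasurable fun p : ℝ × Euc n =>
      ∫ y, Complex.exp (Complex.I * (θ p.1 p.2 y : ℂ)) * A p.1 y := by
    refine StronglyMeasurable.integral_prod_right'
      (f := fun q : (ℝ × Euc n) × Euc n =>
        Complex.exp (Complex.I * (θ q.1.1 q.1.2 q.2 : ℂ)) * A q.1.1 q.2) ?_
    have h₁ : Continuous fun q : (ℝ × Euc n) × Euc n => A q.1.1 q.2 :=
      hA.1.comp ((continuous_fst.comp continuous_fst).prodMk continuous_snd)
    have h₂ : Continuous fun q : (ℝ × Euc n) × Euc n =>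
        Complex.exp (Complex.I * (θ q.1.1 q.1.2 q.2 : ℂ)) :=
      Complex.continuous_exp.comp (continuous_const.mul (Complex.continuous_ofReal.comp hθ))
    exact (h₂.mul h₁).stronglyMeasurable
  obtain ⟨B, hB, hAB⟩ := hA.exists_bound_uIoc a b
  have : IsFiniteMeasure (volume.restrict (Set.uIoc a b)) := by
    rw [Set.uIoc]; infer_instance
  rw [intervalIntegral_integral_swap]
  · simp_rw [intervalIntegral.integral_const_mul]
  · refine ((hg.norm.mul_const (∫ y, B y)).comp_snd (volume.restrict (Set.uIoc a b))).mono'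
      (hg.1.comp_snd.mul hm.aestronglyMeasurable) ?_
    have h : ∀ᵐ s ∂(volume.restrict (Set.uIoc a b)), s ∈ Set.uIoc a b :=
      ae_restrict_mem measurableSet_uIoc
    filter_upwards [Measure.quasiMeasurePreserving_fst.ae h] with p hp
    rw [Function.uncurry_def]
    simp only [norm_mul]
    refine mul_le_mul_of_nonneg_left (norm_integral_le_of_norm_le hB (.of_forall fun y => ?_))
      (norm_nonneg _)
    rw [norm_mul, mul_comm Complex.I, Complex.norm_exp_ofReal_mul_I, one_mul]
    exact hAB p.1 hp y

end LocallyDominated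

section SchwartzCurve

variable {S : ℝ → SchwartzMap (Euc n) ℂ}

theorem continuous_uncurry_schwartz (hS : Continuous S) :
    Continuous fun p : ℝ × Euc n => S p.1 p.2 := by
  have h := (SchwartzMap.toBoundedContinuousFunctionCLM ℝ (Euc n) ℂ).continuous.comp hS
  exact (h.comp continuous_fst).eval continuous_snd

/-- Locally uniform rapid decay along a continuous curve of Schwartz functions. -/
theorem exists_one_add_norm_pow_mul_le (hS : Continuous S) (k : ℕ) (T : ℝ) :
    ∃ C : ℝ, ∀ s, |s| ≤ T → ∀ y, (1 + ‖y‖) ^ k * ‖S s y‖ ≤ C := by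
  have hc : Continuous fun s =>
      ∑ m ∈ Finset.Iic (k, 0), SchwartzMap.seminorm ℝ m.1 m.2 (S s) :=
    continuous_finsetSum _ fun m _ =>
      ((schwartz_withSeminorms ℝ (Euc n) ℂ).continuous_seminorm m).comp hS
  obtain ⟨C, hC⟩ := (isCompact_Icc (a := -T) (b := T)).exists_bound_of_continuousOn hc.continuousOn
  refine ⟨2 ^ k * C, fun s hs y => ?_⟩
  have h := SchwartzMap.one_add_le_sup_seminorm_apply (𝕜 := ℝ) (m := (k, 0)) le_rfl le_rfl (S s) y
  rw [norm_iteratedFDeriv_zero] at h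
  refine h.trans (mul_le_mul_of_nonneg_left (le_trans ?_ ((le_abs_self _).trans
    (hC s (abs_le.1 hs)))) (by positivity))
  refine Seminorm.finset_sup_apply_le (Finset.sum_nonneg fun _ _ => apply_nonneg _ _) fun m hm => ?_
  exact Finset.single_le_sum (f := fun m : ℕ × ℕ => SchwartzMap.seminorm ℝ m.1 m.2 (S s))
    (fun _ _ => apply_nonneg _ _) hm

theorem exists_integrable_bound_schwartz (hS : Continuous S) (T : ℝ) :
    ∃ b : Euc n → ℝ, Integrable b ∧ ∀ s, |s| ≤ T → ∀ y, (1 + ‖y‖) * ‖S s y‖ ≤ b y := by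
  obtain ⟨C, hC⟩ := exists_one_add_norm_pow_mul_le hS (n + 2) T
  refine ⟨fun y => C * (1 + ‖y‖) ^ (-((n : ℝ) + 1)), ?_, fun s hs y => ?_⟩
  · exact (integrable_one_add_norm (by simp)).const_mul C
  · have h := hC s hs y
    have hy : 0 < 1 + ‖y‖ := by positivity
    beta_reduce
    rw [Real.rpow_neg hy.le, ← div_eq_mul_inv, le_div_iff₀ (by positivity)]
    have e : (1 + ‖y‖) ^ ((n : ℝ) + 1) = (1 + ‖y‖) ^ (n + 1) := by
      rw [← Real.rpow_natCast]; push_cast; rfl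
    rw [e]
    calc _ = (1 + ‖y‖) ^ (n + 2) * ‖S s y‖ := by ring
      _ ≤ C := h

theorem locallyDominated_schwartz (hS : Continuous S) : LocallyDominated fun s y => S s y := by
  refine ⟨continuous_uncurry_schwartz hS, fun T => ?_⟩
  obtain ⟨b, hb, h⟩ := exists_integrable_bound_schwartz hS T
  refine ⟨b, hb, fun s hs y => le_trans ?_ (h s hs y)⟩
  nlinarith [mul_nonneg (norm_nonneg y) (norm_nonneg (S s y))]

theorem locallyDominated_inner_mul_schwartz (hS : Continuous S) {w : ℝ → Euc n}
    (hw : Continuous w) : LocallyDominated fun s y => ((⟪y, w s⟫_ℝ : ℝ) : ℂ) * S s y := by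
  refine ⟨?_, fun T => ?_⟩
  · have h : Continuous fun p : ℝ × Euc n => ((⟪p.2, w p.1⟫_ℝ : ℝ) : ℂ) := by fun_prop
    exact h.mul (continuous_uncurry_schwartz hS)
  · obtain ⟨b, hb, h⟩ := exists_integrable_bound_schwartz hS T
    obtain ⟨C, hC⟩ :=
      (isCompact_Icc (a := -T) (b := T)).exists_bound_of_continuousOn hw.continuousOn
    refine ⟨fun y => C * b y, hb.const_mul C, fun s hs y => ?_⟩
    have hw' := hC s (abs_le.1 hs)
    have hin : |⟪y, w s⟫_ℝ| ≤ ‖y‖ * ‖w s‖ := abs_real_inner_le_norm _ _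
    have hC0 := (norm_nonneg _).trans hw'
    rw [norm_mul, Complex.norm_real, Real.norm_eq_abs]
    calc |⟪y, w s⟫_ℝ| * ‖S s y‖ ≤ ((1 + ‖y‖) * C) * ‖S s y‖ := by
          gcongr
          exact hin.trans (mul_le_mul (by linarith) hw' (norm_nonneg _) (by positivity))
      _ = C * ((1 + ‖y‖) * ‖S s y‖) := by ring
      _ ≤ C * b y := mul_le_mul_of_nonneg_left (h s hs y) hC0

end SchwartzCurve

section Fourier

open scoped FourierTransform LineDeriv Laplacian

theorem FT_eq_fourier (f : Euc n → ℂ) (ξ : Euc n) :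
    FT f ξ = 𝓕 f ((2 * Real.pi)⁻¹ • ξ) := by
  rw [FT, Real.fourier_eq']
  congr 1 with y
  rw [real_inner_smul_right, smul_eq_mul]
  congr 2
  have : (Real.pi : ℂ) ≠ 0 := by exact_mod_cast Real.pi_ne_zero
  push_cast
  field_simp

theorem integrable_fourier_schwartz (φ : SchwartzMap (Euc n) ℂ) :
    Integrable (𝓕 (φ : Euc n → ℂ)) := by
  rw [← SchwartzMap.fourier_coe]
  exact (𝓕 φ).integrable

theorem integrable_FT (φ : SchwartzMap (Euc n) ℂ) : Integrable (FT (φ : Euc n → ℂ)) := by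
  rw [funext (FT_eq_fourier (φ : Euc n → ℂ))]
  exact (integrable_fourier_schwartz φ).comp_smul (by positivity)

/-- Fourier inversion: the free evolution at time zero is the identity. -/
theorem U0_zero (φ : SchwartzMap (Euc n) ℂ) : U0 0 (φ : Euc n → ℂ) = φ := by
  ext x
  have hinv := congrFun (φ.continuous.fourierInv_fourier_eq φ.integrable
    (integrable_fourier_schwartz φ)) x
  rw [Real.fourierInv_eq'] at hinv
  rw [← hinv, U0]
  have h := Measure.integral_comp_smul (volume : Measure (Euc n)) (fun v : Euc n =>
    Complex.exp (((2 * Real.pi * ⟪v, x⟫_ℝ : ℝ) : ℂ) * Complex.I) • 𝓕 (φ : Euc n → ℂ) v)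
    (2 * Real.pi)⁻¹
  have hpi : (0 : ℝ) < 2 * Real.pi := by positivity
  rw [finrank_euclideanSpace_fin, inv_pow, inv_inv, abs_of_pos (by positivity)] at h
  rw [inv_smul_eq_iff₀ (by positivity), ← h]
  congr 1 with ξ
  rw [FT_eq_fourier, real_inner_smul_left, smul_eq_mul, real_inner_comm x ξ]
  congr 2
  rw [zero_mul, zero_div, sub_zero, mul_inv_cancel_left₀ hpi.ne', mul_comm]

theorem lapl_schwartz (f : SchwartzMap (Euc n) ℂ) : lapl (f : Euc n → ℂ) = Δ f := by
  ext y
  rw [SchwartzMap.laplacian_eq_sum (EuclideanSpace.basisFun (Fin n) ℝ), sum_apply]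
  simp only [EuclideanSpace.basisFun_apply]
  rfl

theorem FT_lineDeriv (f : SchwartzMap (Euc n) ℂ) (m ζ : Euc n) :
    FT (∂_{m} f : SchwartzMap (Euc n) ℂ) ζ = Complex.I * ((⟪ζ, m⟫_ℝ : ℝ) : ℂ) * FT f ζ := by
  have hm : (inner ℝ · m : Euc n → ℝ).HasTemperateGrowth := by fun_prop
  rw [FT_eq_fourier, FT_eq_fourier, ← SchwartzMap.fourier_coe, ← SchwartzMap.fourier_coe,
    SchwartzMap.fourier_lineDerivOp_eq, smul_apply,
    SchwartzMap.smulLeftCLM_apply_apply hm, real_inner_smul_left, Complex.real_smul, smul_eq_mul]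
  have : (Real.pi : ℂ) ≠ 0 := by exact_mod_cast Real.pi_ne_zero
  push_cast
  field_simp

theorem FT_laplacian (f : SchwartzMap (Euc n) ℂ) (ζ : Euc n) :
    FT (Δ f : SchwartzMap (Euc n) ℂ) ζ = -((‖ζ‖ ^ 2 : ℝ) : ℂ) * FT f ζ := by
  have hsum : FT (Δ f : SchwartzMap (Euc n) ℂ) ζ =
      ∑ j, FT (∂_{EuclideanSpace.basisFun (Fin n) ℝ j}
        (∂_{EuclideanSpace.basisFun (Fin n) ℝ j} f) : SchwartzMap (Euc n) ℂ) ζ := by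
    simp_rw [FT_eq_fourier, ← SchwartzMap.fourier_coe]
    rw [SchwartzMap.laplacian_eq_sum (EuclideanSpace.basisFun (Fin n) ℝ),
      ← sum_apply, FourierTransform.fourier_sum]
  rw [hsum, EuclideanSpace.real_norm_sq_eq]
  simp_rw [FT_lineDeriv, EuclideanSpace.basisFun_apply, EuclideanSpace.inner_single_right]
  push_cast
  rw [neg_mul, Finset.sum_mul, ← Finset.sum_neg_distrib]
  refine Finset.sum_congr rfl fun j _ => ?_
  simp only [one_mul, RCLike.conj_to_real]
  linear_combination ((ζ j : ℝ) : ℂ) ^ 2 * FT (f : Euc n → ℂ) ζ * Complex.I_sq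

end Fourier

/-- The phase obtained by expanding the wave packet centred at `x` with frequency `ξ` and
evolved for time `s` into plane waves of frequency `η`. -/
def packetPhase (s : ℝ) (x ξ η y : Euc n) : ℝ :=
  ⟪x, η⟫_ℝ + s * ‖η‖ ^ 2 / 2 - ⟪y, η + ξ⟫_ℝ

@[fun_prop]
theorem Continuous.packetPhase {α : Type*} [TopologicalSpace α] {s : α → ℝ} {x ξ η y : α → Euc n}
    (hs : Continuous s) (hx : Continuous x) (hξ : Continuous ξ) (hη : Continuous η)
    (hy : Continuous y) : Continuous fun a => packetPhase (s a) (x a) (ξ a) (η a) (y a) := by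
  unfold _root_.packetPhase
  fun_prop

theorem integrable_mul_exp_mul_prod {g A : Euc n → ℂ} (hg : Integrable g) (hA : Integrable A)
    {θ : Euc n → Euc n → ℝ} (hθ : Continuous (Function.uncurry θ)) :
    Integrable (Function.uncurry fun η y => g η * (Complex.exp (Complex.I * (θ η y : ℂ)) * A y))
      (volume.prod volume) := by
  have hc : Continuous fun p : Euc n × Euc n =>
      Complex.exp (Complex.I * ((Function.uncurry θ p : ℝ) : ℂ)) := by fun_prop
  refine (hg.mul_prod hA).norm.mono'
    (hg.1.comp_fst.mul (hc.aestronglyMeasurable.mul hA.1.comp_snd)) (.of_forall fun p => ?_)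
  simp only [Function.uncurry_def, norm_mul]
  rw [mul_comm Complex.I, Complex.norm_exp_ofReal_mul_I, one_mul]

theorem integrable_mul_integral_exp_mul {g A : Euc n → ℂ} (hg : Integrable g) (hA : Integrable A)
    {θ : Euc n → Euc n → ℝ} (hθ : Continuous (Function.uncurry θ)) :
    Integrable fun η => g η * ∫ y, Complex.exp (Complex.I * (θ η y : ℂ)) * A y := by
  simp_rw [← integral_const_mul]
  exact (integrable_mul_exp_mul_prod hg hA hθ).integral_prod_left

theorem integrable_conj {g : Euc n → ℂ} (hg : Integrable g) :
    Integrable fun η => (starRingEnd ℂ) (g η) :=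
  (LinearIsometryEquiv.integrable_comp_iff Complex.conjLIE).2 hg

/-- Plane wave expansion of the integral of a function against an evolved wave packet. -/
theorem integral_conj_U0_mul {φ A : Euc n → ℂ} (hφ : Integrable (FT φ)) (hA : Integrable A)
    (s : ℝ) (x ξ : Euc n) :
    ∫ y, (starRingEnd ℂ) (U0 s φ (y - x)) * A y *
        Complex.exp (-Complex.I * ((⟪y, ξ⟫_ℝ : ℝ) : ℂ)) =
      ((((2 * Real.pi) ^ n)⁻¹ : ℝ) : ℂ) * ∫ η, (starRingEnd ℂ) (FT φ η) *
        ∫ y, Complex.exp (Complex.I * (packetPhase s x ξ η y : ℂ)) * A y := by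
  simp_rw [← integral_const_mul]
  rw [integral_integral_swap]
  · congr 1 with y
    rw [U0, Complex.real_smul, map_mul, Complex.conj_ofReal, ← integral_conj, integral_const_mul,
      mul_assoc, mul_assoc, ← integral_mul_const]
    congr 2 with η
    have h : Complex.exp (Complex.I * (packetPhase s x ξ η y : ℂ)) =
        (starRingEnd ℂ) (Complex.exp (Complex.I *
          ((⟪y - x, η⟫_ℝ - s * ‖η‖ ^ 2 / 2 : ℝ) : ℂ))) *
            Complex.exp (-Complex.I * ((⟪y, ξ⟫_ℝ : ℝ) : ℂ)) := by
      rw [← Complex.exp_conj, ← Complex.exp_add, map_mul, Complex.conj_I, Complex.conj_ofReal]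
      congr 1
      rw [packetPhase, inner_add_right, inner_sub_left]
      push_cast
      ring
    rw [h, map_mul]
    ring
  · exact (integrable_mul_exp_mul_prod (integrable_conj hφ) hA
      (by unfold Function.uncurry; fun_prop)).const_mul _

theorem integral_exp_packetPhase_mul (s : ℝ) (x ξ η : Euc n) (f : Euc n → ℂ) :
    ∫ y, Complex.exp (Complex.I * (packetPhase s x ξ η y : ℂ)) * f y =
      Complex.exp (Complex.I * ((⟪x, η⟫_ℝ + s * ‖η‖ ^ 2 / 2 : ℝ) : ℂ)) * FT f (η + ξ) := by
  rw [FT, ← integral_const_mul]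
  congr 1 with y
  rw [← mul_assoc, ← Complex.exp_add, packetPhase]
  congr 2
  push_cast
  ring

/-- Plane waves are eigenfunctions of the Laplacian, in integrated form. -/
theorem integral_exp_packetPhase_mul_laplacian (s : ℝ) (x ξ η : Euc n)
    (f : SchwartzMap (Euc n) ℂ) :
    ∫ y, Complex.exp (Complex.I * (packetPhase s x ξ η y : ℂ)) * lapl f y =
      -((‖η + ξ‖ ^ 2 : ℝ) : ℂ) *
        ∫ y, Complex.exp (Complex.I * (packetPhase s x ξ η y : ℂ)) * f y := by
  rw [integral_exp_packetPhase_mul, integral_exp_packetPhase_mul, lapl_schwartz, FT_laplacian]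
  ring

theorem hasDerivAt_packetPhase {X Ξ : ℝ → Euc n} {s : ℝ} {v w : Euc n}
    (hX : HasDerivAt X v s) (hΞ : HasDerivAt Ξ w s) (η y : Euc n) :
    HasDerivAt (fun r => packetPhase r (X r) (Ξ r) η y)
      (⟪v, η⟫_ℝ + ‖η‖ ^ 2 / 2 - ⟪y, w⟫_ℝ) s := by
  have h₁ : HasDerivAt (fun r => ⟪X r, η⟫_ℝ) ⟪v, η⟫_ℝ s := by
    simpa using hX.inner ℝ (hasDerivAt_const s η)
  have h₂ : HasDerivAt (fun r => ⟪y, η + Ξ r⟫_ℝ) ⟪y, w⟫_ℝ s := by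
    simpa using (hasDerivAt_const s y).inner ℝ (hΞ.const_add η)
  have h₃ : HasDerivAt (fun r : ℝ => r * ‖η‖ ^ 2 / 2) (‖η‖ ^ 2 / 2) s := by
    simpa using ((hasDerivAt_id s).mul_const (‖η‖ ^ 2)).div_const 2
  exact (h₁.add h₃).sub h₂

theorem continuous_gradV_comp {V : ℝ × Euc n → ℝ} (hV : ContDiff ℝ (⊤ : ℕ∞) V) {X : ℝ → Euc n}
    (hX : Continuous X) : Continuous fun s => gradV V s (X s) := by
  have h : ContDiff ℝ 0 fun s => fderiv ℝ (fun z => V (s, z)) (X s) :=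
    ContDiff.fderiv (f := fun s z => V (s, z)) (m := (⊤ : ℕ∞)) hV (contDiff_zero.2 hX) (by simp)
  exact (InnerProductSpace.toDual ℝ (Euc n)).symm.continuous.comp h.continuous

/-- Rate of change of the phase of a wave packet carried by the Hamiltonian flow. -/
def phaseRate (V : ℝ × Euc n → ℝ) (X Ξ : ℝ → Euc n) (s : ℝ) : ℝ :=
  ‖Ξ s‖ ^ 2 / 2 + (V (s, X s) - ⟪X s, gradV V s (X s)⟫_ℝ)

/-- Remainder of the first order Taylor expansion of the potential along a trajectory. -/
def taylorRemainder (V : ℝ × Euc n → ℝ) (X : ℝ → Euc n) (s : ℝ) (y : Euc n) : ℝ :=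
  V (s, y) - V (s, X s) - ⟪gradV V s (X s), y - X s⟫_ℝ

/-- Total phase of a plane wave component carried by the Hamiltonian flow. -/
def flowPhase (V : ℝ × Euc n → ℝ) (X Ξ : ℝ → Euc n) (s : ℝ) (η y : Euc n) : ℝ :=
  (∫ r in (0 : ℝ)..s, phaseRate V X Ξ r) + packetPhase s (X s) (Ξ s) η y

section Flow

variable {V : ℝ × Euc n → ℝ} {X Ξ : ℝ → Euc n}

theorem IsHamiltonSol.continuous_fst (h : IsHamiltonSol V X Ξ) : Continuous X :=
  continuous_iff_continuousAt.2 fun s => (h.1 s).continuousAt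

theorem IsHamiltonSol.continuous_snd (h : IsHamiltonSol V X Ξ) : Continuous Ξ :=
  continuous_iff_continuousAt.2 fun s => (h.2 s).continuousAt

theorem continuous_phaseRate (hV : ContDiff ℝ (⊤ : ℕ∞) V) (h : IsHamiltonSol V X Ξ) :
    Continuous (phaseRate V X Ξ) := by
  have hX := h.continuous_fst
  have hΞ := h.continuous_snd
  have hG := continuous_gradV_comp hV hX
  have hVX : Continuous fun s => V (s, X s) := hV.continuous.comp (continuous_id.prodMk hX)
  unfold phaseRate
  fun_prop

theorem hasDerivAt_integral_phaseRate (hV : ContDiff ℝ (⊤ : ℕ∞) V) (h : IsHamiltonSol V X Ξ)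
    (s : ℝ) : HasDerivAt (fun s => ∫ r in (0 : ℝ)..s, phaseRate V X Ξ r) (phaseRate V X Ξ s) s :=
  ((continuous_phaseRate hV h).integral_hasStrictDerivAt 0 s).hasDerivAt

theorem continuous_flowPhase (hV : ContDiff ℝ (⊤ : ℕ∞) V) (h : IsHamiltonSol V X Ξ) :
    Continuous fun p : (ℝ × Euc n) × Euc n => flowPhase V X Ξ p.1.1 p.1.2 p.2 := by
  have hX := h.continuous_fst
  have hΞ := h.continuous_snd
  have hΛ : Continuous fun s => ∫ r in (0 : ℝ)..s, phaseRate V X Ξ r :=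
    continuous_iff_continuousAt.2 fun s => (hasDerivAt_integral_phaseRate hV h s).continuousAt
  unfold flowPhase
  fun_prop

theorem exp_flowPhase (s : ℝ) (η y : Euc n) :
    Complex.exp (Complex.I * (flowPhase V X Ξ s η y : ℂ)) =
      Complex.exp (Complex.I * ((∫ r in (0 : ℝ)..s, phaseRate V X Ξ r : ℝ) : ℂ)) *
        Complex.exp (Complex.I * (packetPhase s (X s) (Ξ s) η y : ℂ)) := by
  rw [← Complex.exp_add, flowPhase]
  push_cast
  ring_nf

/-- Plane wave expansion with the phase accumulated along the flow. -/
theorem integral_conj_U0_mul_flow {φ A : Euc n → ℂ} (hφ : Integrable (FT φ)) (hA : Integrable A)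
    (s : ℝ) :
    ((((2 * Real.pi) ^ n)⁻¹ : ℝ) : ℂ) * ∫ η, (starRingEnd ℂ) (FT φ η) *
        ∫ y, Complex.exp (Complex.I * (flowPhase V X Ξ s η y : ℂ)) * A y =
      Complex.exp (Complex.I * ((∫ r in (0 : ℝ)..s, phaseRate V X Ξ r : ℝ) : ℂ)) *
        ∫ y, (starRingEnd ℂ) (U0 s φ (y - X s)) * A y *
          Complex.exp (-Complex.I * ((⟪y, Ξ s⟫_ℝ : ℝ) : ℂ)) := by
  rw [integral_conj_U0_mul hφ hA]
  simp_rw [exp_flowPhase, mul_assoc, integral_const_mul]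
  rw [mul_left_comm, ← integral_const_mul
    (Complex.exp (Complex.I * ((∫ r in (0 : ℝ)..s, phaseRate V X Ξ r : ℝ) : ℂ)))]
  simp_rw [mul_left_comm]

variable {S S' : ℝ → SchwartzMap (Euc n) ℂ}

theorem continuous_laplacian_schwartz (hS : Continuous S) :
    Continuous fun s => LineDeriv.laplacianCLM ℝ (Euc n) (SchwartzMap (Euc n) ℂ) (S s) :=
  (LineDeriv.laplacianCLM ℝ (Euc n) (SchwartzMap (Euc n) ℂ)).continuous.comp hS

theorem locallyDominated_lapl (hS : Continuous S) :
    LocallyDominated fun s y => lapl (S s) y := by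
  convert! locallyDominated_schwartz (continuous_laplacian_schwartz hS) using 3 with s y
  rw [lapl_schwartz]
  rfl

theorem locallyDominated_taylorRemainder_mul (hV : ContDiff ℝ (⊤ : ℕ∞) V)
    (hX : Continuous X) (hS : Continuous S) (hS' : Continuous S')
    (hPDE : ∀ s y, Complex.I * S' s y + (1 / 2 : ℂ) * lapl (S s) y
      - ((V (s, y) : ℝ) : ℂ) * S s y = 0) :
    LocallyDominated fun s y => (taylorRemainder V X s y : ℂ) * S s y := by
  have hG := continuous_gradV_comp hV hX
  have hVX : Continuous fun s => V (s, X s) := hV.continuous.comp (continuous_id.prodMk hX)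
  have h₁ := (locallyDominated_schwartz hS').const_mul (a := fun _ => Complex.I) continuous_const
  have h₂ := (locallyDominated_lapl hS).const_mul (a := fun _ => 1 / 2) continuous_const
  have h₃ := (locallyDominated_schwartz hS).const_mul
    (a := fun s => ((V (s, X s) - ⟪gradV V s (X s), X s⟫_ℝ : ℝ) : ℂ)) (by fun_prop)
  have h₄ := locallyDominated_inner_mul_schwartz hS hG
  convert! ((h₁.add h₂).sub h₃).sub h₄ using 3 with s y
  rw [taylorRemainder, inner_sub_right, real_inner_comm y]
  push_cast
  linear_combination -hPDE s y

/-- Duhamel formula for a single plane wave component. -/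
theorem integral_flowPhase_sub (hV : ContDiff ℝ (⊤ : ℕ∞) V) (h : IsHamiltonSol V X Ξ)
    (hS : Continuous S) (hS' : Continuous S')
    (hderiv : ∀ s y, HasDerivAt (fun r => S r y) (S' s y) s)
    (hPDE : ∀ s y, Complex.I * S' s y + (1 / 2 : ℂ) * lapl (S s) y
      - ((V (s, y) : ℝ) : ℂ) * S s y = 0) (η : Euc n) (a b : ℝ) :
    (∫ y, Complex.exp (Complex.I * (flowPhase V X Ξ b η y : ℂ)) * S b y)
        - ∫ y, Complex.exp (Complex.I * (flowPhase V X Ξ a η y : ℂ)) * S a y =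
      -Complex.I * ∫ s in a..b, ∫ y, Complex.exp (Complex.I * (flowPhase V X Ξ s η y : ℂ)) *
        ((taylorRemainder V X s y : ℂ) * S s y) := by
  have hX := h.continuous_fst
  have hΞ := h.continuous_snd
  have hG := continuous_gradV_comp hV hX
  have hrate := continuous_phaseRate hV h
  have hθ : Continuous (Function.uncurry fun s y => flowPhase V X Ξ s η y) :=
    (continuous_flowPhase hV h).comp
      (f := fun p : ℝ × Euc n => ((p.1, η), p.2)) (by fun_prop)
  have hDS := locallyDominated_schwartz hS
  have hDρ := locallyDominated_taylorRemainder_mul hV hX hS hS' hPDE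
  have hDL := locallyDominated_lapl hS
  have hB := ((hDS.const_mul (a := fun s => Complex.I *
      ((phaseRate V X Ξ s + ⟪Ξ s, η⟫_ℝ + ‖η‖ ^ 2 / 2 : ℝ) : ℂ)) (by fun_prop)).add
    ((locallyDominated_inner_mul_schwartz hS hG).const_mul (a := fun _ => Complex.I)
      continuous_const)).add (locallyDominated_schwartz hS')
  rw [(hDS.exp_mul hθ).integral_sub_integral (hB.exp_mul hθ), ← intervalIntegral.integral_const_mul]
  · congr 1 with s
    have hlap : ∫ y, Complex.exp (Complex.I * (flowPhase V X Ξ s η y : ℂ)) * lapl (S s) y =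
        -((‖η + Ξ s‖ ^ 2 : ℝ) : ℂ) *
          ∫ y, Complex.exp (Complex.I * (flowPhase V X Ξ s η y : ℂ)) * S s y := by
      simp_rw [exp_flowPhase, mul_assoc, integral_const_mul,
        integral_exp_packetPhase_mul_laplacian]
      ring
    have hsplit : ∀ y, Complex.exp (Complex.I * (flowPhase V X Ξ s η y : ℂ)) *
        (Complex.I * ((phaseRate V X Ξ s + ⟪Ξ s, η⟫_ℝ + ‖η‖ ^ 2 / 2 : ℝ) : ℂ) * S s y +
          Complex.I * (((⟪y, gradV V s (X s)⟫_ℝ : ℝ) : ℂ) * S s y) + S' s y) =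
        -Complex.I * (Complex.exp (Complex.I * (flowPhase V X Ξ s η y : ℂ)) *
          ((taylorRemainder V X s y : ℂ) * S s y)) +
        Complex.I / 2 * (Complex.exp (Complex.I * (flowPhase V X Ξ s η y : ℂ)) * lapl (S s) y +
          ((‖η + Ξ s‖ ^ 2 : ℝ) : ℂ) *
            (Complex.exp (Complex.I * (flowPhase V X Ξ s η y : ℂ)) * S s y)) := by
      intro y
      rw [taylorRemainder, phaseRate, norm_add_sq_real, inner_sub_right, real_inner_comm y,
        real_inner_comm (Ξ s) η, real_inner_comm (X s)]
      push_cast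
      linear_combination (-Complex.I *
        Complex.exp (Complex.I * (flowPhase V X Ξ s η y : ℂ))) * hPDE s y +
        Complex.exp (Complex.I * (flowPhase V X Ξ s η y : ℂ)) * S' s y * Complex.I_sq
    simp_rw [hsplit]
    have hiρ := (hDρ.exp_mul hθ).integrable s
    have hiL := (hDL.exp_mul hθ).integrable s
    have hiS := (hDS.exp_mul hθ).integrable s
    rw [integral_add (hiρ.const_mul _) ((hiL.fun_add (hiS.const_mul _)).const_mul _),
      integral_const_mul, integral_const_mul, integral_add hiL (hiS.const_mul _),
      integral_const_mul, hlap]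
    ring
  · intro s y
    have hp := ((hasDerivAt_integral_phaseRate hV h s).add
      (hasDerivAt_packetPhase (h.1 s) (h.2 s) η y)).ofReal_comp.const_mul Complex.I
    refine (hp.cexp.mul (hderiv s y)).congr_deriv ?_
    rw [inner_neg_right]
    simp only [flowPhase, Pi.add_apply]
    push_cast
    ring

end Flow

/-- Duhamel/integral representation of the wave packet transform of a
Schwartz-class solution along the Hamiltonian flow (formula (6)/(7) of Kato–Ito). -/
theorem wavePacket_integral_representation (hn : 1 ≤ n) (V : ℝ × Euc n → ℝ) (ρ : ℝ)
    (hρ0 : 0 ≤ ρ) (hρ2 : ρ < 2) (hV : SubQuadratic ρ V)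
    (u : ℝ → Euc n → ℂ)
    (hu_smooth : ContDiff ℝ (⊤ : ℕ∞) fun p : ℝ × Euc n => u p.1 p.2)
    (Us : ℝ → SchwartzMap (Euc n) ℂ) (hUs : ∀ t : ℝ, (⇑(Us t) : Euc n → ℂ) = u t)
    (hUscont : Continuous Us)
    (Us' : ℝ → SchwartzMap (Euc n) ℂ) (hUs'cont : Continuous Us')
    (hUs'deriv : ∀ (t : ℝ) (x : Euc n), HasDerivAt (fun s => u s x) (Us' t x) t)
    (hPDE : ∀ (t : ℝ) (x : Euc n),
      Complex.I * deriv (fun s => u s x) t + (1 / 2 : ℂ) * lapl (u t) x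
        - ((V (t, x) : ℝ) : ℂ) * u t x = 0)
    (φ₀ : SchwartzMap (Euc n) ℂ)
    (F : ℝ → Euc n → Euc n → ℂ)
    (hF : ∀ (t : ℝ) (x ξ : Euc n), F t x ξ = WPT (U0 t ⇑φ₀) (u t) x ξ)
    (R : ℝ → Euc n → Euc n → ℂ)
    (hR : ∀ (t : ℝ) (x ξ : Euc n), R t x ξ =
      ∫ y, (starRingEnd ℂ) (U0 t ⇑φ₀ (y - x)) *
        ((V (t, y) - V (t, x) - ⟪gradV V t x, y - x⟫_ℝ : ℝ) : ℂ) * u t y *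
          Complex.exp (-Complex.I * ((⟪y, ξ⟫_ℝ : ℝ) : ℂ)))
    (t : ℝ) (x ξ : Euc n) (X Ξ : ℝ → Euc n)
    (hXΞ : IsHamiltonSol V X Ξ) (hXt : X t = x) (hΞt : Ξ t = ξ) :
    F t x ξ =
      Complex.exp (-Complex.I *
          ((∫ s in (0 : ℝ)..t, (‖Ξ s‖ ^ 2 / 2
            + (V (s, X s) - ⟪X s, gradV V s (X s)⟫_ℝ)) : ℝ) : ℂ)) *
        WPT ⇑φ₀ (u 0) (X 0) (Ξ 0)
      - Complex.I * ∫ s in (0 : ℝ)..t,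
          Complex.exp (-Complex.I *
              ((∫ s₁ in s..t, (‖Ξ s₁‖ ^ 2 / 2
                + (V (s₁, X s₁) - ⟪X s₁, gradV V s₁ (X s₁)⟫_ℝ)) : ℝ) : ℂ)) *
            R s (X s) (Ξ s) := by
  obtain ⟨hVs, -⟩ := hV
  have hS : ∀ s y, u s y = Us s y := fun s y => (congrFun (hUs s) y).symm
  have hderiv : ∀ s y, HasDerivAt (fun r => Us r y) (Us' s y) s := fun s y => by
    simpa only [hS] using hUs'deriv s y
  have hPDE' : ∀ s y, Complex.I * Us' s y + (1 / 2 : ℂ) * lapl (Us s) y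
      - ((V (s, y) : ℝ) : ℂ) * Us s y = 0 := fun s y => by
    rw [← hPDE s y, (hUs'deriv s y).deriv, hUs]
  have hg := integrable_FT φ₀
  have hθ := continuous_flowPhase hVs hXΞ
  have hDρ := locallyDominated_taylorRemainder_mul hVs hXΞ.continuous_fst hUscont hUs'cont hPDE'
  have hrate := continuous_phaseRate hVs hXΞ
  have hη : ∀ s, Integrable fun η => (starRingEnd ℂ) (FT (φ₀ : Euc n → ℂ) η) *
      ∫ y, Complex.exp (Complex.I * (flowPhase V X Ξ s η y : ℂ)) * Us s y := fun s =>
    integrable_mul_integral_exp_mul (integrable_conj hg) (Us s).integrable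
      (hθ.comp (f := fun p : Euc n × Euc n => ((s, p.1), p.2)) (by fun_prop))
  have hWPT : ∀ s, Complex.exp (Complex.I * ((∫ r in (0 : ℝ)..s, phaseRate V X Ξ r : ℝ) : ℂ)) *
      WPT (U0 s φ₀) (u s) (X s) (Ξ s) =
      ((((2 * Real.pi) ^ n)⁻¹ : ℝ) : ℂ) * ∫ η, (starRingEnd ℂ) (FT (φ₀ : Euc n → ℂ) η) *
        ∫ y, Complex.exp (Complex.I * (flowPhase V X Ξ s η y : ℂ)) * Us s y := fun s => by
    rw [integral_conj_U0_mul_flow hg (Us s).integrable, hUs, WPT]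
  have hRint : ∀ s, Complex.exp (Complex.I * ((∫ r in (0 : ℝ)..s, phaseRate V X Ξ r : ℝ) : ℂ)) *
      R s (X s) (Ξ s) =
      ((((2 * Real.pi) ^ n)⁻¹ : ℝ) : ℂ) * ∫ η, (starRingEnd ℂ) (FT (φ₀ : Euc n → ℂ) η) *
        ∫ y, Complex.exp (Complex.I * (flowPhase V X Ξ s η y : ℂ)) *
          ((taylorRemainder V X s y : ℂ) * Us s y) := fun s => by
    rw [integral_conj_U0_mul_flow hg (hDρ.integrable s), hR]
    simp only [hS, taylorRemainder, mul_assoc]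
  have hduh : Complex.exp (Complex.I * ((∫ r in (0 : ℝ)..t, phaseRate V X Ξ r : ℝ) : ℂ)) *
      WPT (U0 t φ₀) (u t) (X t) (Ξ t) - WPT φ₀ (u 0) (X 0) (Ξ 0) =
      -Complex.I * ∫ s in (0 : ℝ)..t,
        Complex.exp (Complex.I * ((∫ r in (0 : ℝ)..s, phaseRate V X Ξ r : ℝ) : ℂ)) *
          R s (X s) (Ξ s) := by
    have h0 := hWPT 0
    rw [U0_zero, intervalIntegral.integral_same, Complex.ofReal_zero, mul_zero, Complex.exp_zero,
      one_mul] at h0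
    simp_rw [hRint]
    rw [hWPT, h0, ← mul_sub, ← integral_sub (hη t) (hη 0), intervalIntegral.integral_const_mul,
      ← hDρ.integral_mul_intervalIntegral hθ (integrable_conj hg)]
    simp_rw [← mul_sub, integral_flowPhase_sub hVs hXΞ hUscont hUs'cont hderiv hPDE',
      mul_left_comm _ (-Complex.I), integral_const_mul]
    ring
  rw [hF, ← hXt, ← hΞt]
  change _ = Complex.exp (-Complex.I * ((∫ s in (0 : ℝ)..t, phaseRate V X Ξ s : ℝ) : ℂ)) *
      WPT φ₀ (u 0) (X 0) (Ξ 0) - Complex.I * ∫ s in (0 : ℝ)..t,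
        Complex.exp (-Complex.I * ((∫ r in s..t, phaseRate V X Ξ r : ℝ) : ℂ)) * R s (X s) (Ξ s)
  have hexp : ∀ s, Complex.exp (-Complex.I * ((∫ r in s..t, phaseRate V X Ξ r : ℝ) : ℂ)) =
      Complex.exp (-Complex.I * ((∫ r in (0 : ℝ)..t, phaseRate V X Ξ r : ℝ) : ℂ)) *
        Complex.exp (Complex.I * ((∫ r in (0 : ℝ)..s, phaseRate V X Ξ r : ℝ) : ℂ)) := fun s => by
    rw [← Complex.exp_add, ← intervalIntegral.integral_interval_sub_left
      (hrate.intervalIntegrable 0 t) (hrate.intervalIntegrable 0 s)]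
    push_cast
    ring_nf
  have hone := hexp t
  rw [intervalIntegral.integral_same, Complex.ofReal_zero, mul_zero, Complex.exp_zero] at hone
  have hshift : ∫ s in (0 : ℝ)..t, Complex.exp (-Complex.I *
        ((∫ r in s..t, phaseRate V X Ξ r : ℝ) : ℂ)) * R s (X s) (Ξ s) =
      Complex.exp (-Complex.I * ((∫ r in (0 : ℝ)..t, phaseRate V X Ξ r : ℝ) : ℂ)) *
        ∫ s in (0 : ℝ)..t,
          Complex.exp (Complex.I * ((∫ r in (0 : ℝ)..s, phaseRate V X Ξ r : ℝ) : ℂ)) *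
            R s (X s) (Ξ s) := by
    rw [← intervalIntegral.integral_const_mul]
    congr 1 with s
    rw [hexp s, mul_assoc]
  rw [hshift]
  linear_combination WPT (U0 t φ₀) (u t) (X t) (Ξ t) * hone +
    Complex.exp (-Complex.I * ((∫ r in (0 : ℝ)..t, phaseRate V X Ξ r : ℝ) : ℂ)) * hduh

end
end

section
/- Let n ≥ 1 and let V : ℝ × ℝⁿ → ℝ be C^∞ and sub-quadratic with exponent ρ ∈ [0,2). Let K ⊂ ℝⁿ be compact, a ≥ 1, t₀ > 0 and 0 < p < 1. Then there exists λ₀ ≥ 1 such that for all λ ≥ λ₀, all x ∈ K, all ξ ∈ ℝⁿ with a^{−1} ≤ |ξ| ≤ a, and all s ∈ [0, t₀] with t₀ − s ≥ λ^{p−1}: (1/(2a)) (t₀ − s) λ ≤ | x(s; t₀, x, λξ) | ≤ 2a (t₀ − s) λ. -/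
open MeasureTheory Complex
open scoped InnerProductSpace BigOperators

noncomputable section

variable {n : ℕ}

/-- A power of exponent less than one is bounded by a line of arbitrarily small slope. -/
theorem exists_mul_one_add_rpow_le {C σ ε : ℝ} (hC : 0 < C) (hσ : σ < 1) (hε : 0 < ε) :
    ∃ M : ℝ, 0 ≤ M ∧ ∀ r : ℝ, 0 ≤ r → C * (1 + r) ^ σ ≤ ε * r + M := by
  have hlim := (tendsto_rpow_neg_atTop (sub_pos.2 hσ)).eventually_le_const (div_pos hε hC)
  obtain ⟨y₀, hy₀⟩ := Filter.eventually_atTop.1 hlim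
  refine ⟨ε + C * |y₀|, by positivity, fun r hr => ?_⟩
  have hy : 0 < 1 + r := by linarith
  have hnonneg : 0 ≤ C * |y₀| := by positivity
  rcases le_total y₀ (1 + r) with h | h
  · have hsplit : (1 + r) ^ σ = (1 + r) ^ (-(1 - σ)) * (1 + r) := by
      rw [← Real.rpow_add_one hy.ne']
      congr 1
      ring
    have hle : C * (1 + r) ^ (-(1 - σ)) ≤ ε := by
      have := (le_div_iff₀ hC).1 (hy₀ _ h)
      linarith
    calc C * (1 + r) ^ σ = C * (1 + r) ^ (-(1 - σ)) * (1 + r) := by rw [hsplit]; ring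
      _ ≤ ε * (1 + r) := by gcongr
      _ ≤ ε * r + (ε + C * |y₀|) := by linarith
  · have hpow : (1 + r) ^ σ ≤ |y₀| := by
      calc (1 + r) ^ σ ≤ (1 + r) ^ (1 : ℝ) :=
            Real.rpow_le_rpow_of_exponent_le (by linarith) hσ.le
        _ = 1 + r := Real.rpow_one _
        _ ≤ |y₀| := h.trans (le_abs_self _)
    have := mul_le_mul_of_nonneg_left hpow hC.le
    nlinarith [mul_nonneg hε.le hr]

/-- The force field of a sub-quadratic potential grows at most linearly, with arbitrarily small
slope. -/
theorem SubQuadratic.exists_norm_gradV_le {V : ℝ × Euc n → ℝ} {ρ ε : ℝ} (hV : SubQuadratic ρ V)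
    (hρ2 : ρ < 2) (hε : 0 < ε) :
    ∃ M : ℝ, 0 ≤ M ∧ ∀ (t : ℝ) (x : Euc n), ‖gradV V t x‖ ≤ ε * ‖x‖ + M := by
  obtain ⟨C, hC, hbound⟩ := hV.2 1
  obtain ⟨M, hM, hle⟩ :=
    exists_mul_one_add_rpow_le (σ := ρ - (1 : ℕ)) hC (by push_cast; linarith) hε
  refine ⟨M, hM, fun t x => ?_⟩
  calc ‖gradV V t x‖ = ‖iteratedFDeriv ℝ 1 (fun z => V (t, z)) x‖ := by
        rw [norm_iteratedFDeriv_one, gradV, gradient, LinearIsometryEquiv.norm_map]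
    _ ≤ C * (1 + ‖x‖) ^ (ρ - (1 : ℕ)) := hbound t x
    _ ≤ ε * ‖x‖ + M := hle _ (norm_nonneg x)

/-- Deviation from uniform motion of a trajectory whose acceleration grows at most linearly in the
position. -/
theorem norm_sub_uniform_motion_le {E : Type*} [NormedAddCommGroup E] [NormedSpace ℝ E]
    {x v g : ℝ → E} {ε M T : ℝ} (hx : ∀ u, HasDerivAt x (v u) u)
    (hv : ∀ u, HasDerivAt v (g u) u) (hε0 : 0 ≤ ε) (hε1 : ε ≤ 1) (hM : 0 ≤ M)
    (hg : ∀ u, ‖g u‖ ≤ ε * ‖x u‖ + M) {u : ℝ} (hu : u ∈ Set.Icc 0 T) :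
    ‖x u - x 0 - u • v 0‖ ≤ (ε * (‖x 0‖ + T * ‖v 0‖) + M) * Real.exp T * u := by
  set B : ℝ := ε * (‖x 0‖ + T * ‖v 0‖) + M
  have hT : 0 ≤ T := hu.1.trans hu.2
  have hB0 : 0 ≤ B := by positivity
  have hz : ∀ r, HasDerivAt (fun r => x r - x 0 - r • v 0) (v r - v 0) r := fun r => by
    simpa using ((hx r).sub_const (x 0)).fun_sub ((hasDerivAt_id r).smul_const (v 0))
  have hw : ∀ r, HasDerivAt (fun r => v r - v 0) (g r) r := fun r => (hv r).sub_const _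
  have hpair : ∀ r, HasDerivAt (fun r => (x r - x 0 - r • v 0, v r - v 0))
      (v r - v 0, g r) r := fun r => (hz r).prodMk (hw r)
  have hspeed : ∀ r ∈ Set.Icc 0 T, ‖v r - v 0‖ ≤ B * Real.exp T := fun r hr => by
    have hgron := norm_le_gronwallBound_of_norm_deriv_right_le (δ := 0) (K := 1) (ε := B)
      (a := 0) (b := T) (fun r _ => (hpair r).continuousAt.continuousWithinAt)
      (fun r _ => (hpair r).hasDerivWithinAt) (by simp) (fun r hr => by
        have hxr : ‖x r‖ ≤ ‖x r - x 0 - r • v 0‖ + (‖x 0‖ + T * ‖v 0‖) := by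
          calc ‖x r‖ = ‖(x r - x 0 - r • v 0) + (x 0 + r • v 0)‖ := by congr 1; abel
            _ ≤ ‖x r - x 0 - r • v 0‖ + (‖x 0‖ + ‖r • v 0‖) :=
              (norm_add_le _ _).trans (by gcongr; exact norm_add_le _ _)
            _ ≤ _ := by
              rw [norm_smul, Real.norm_of_nonneg hr.1]
              gcongr
              exact hr.2.le
        have hgr : ‖g r‖ ≤ ‖x r - x 0 - r • v 0‖ + B := by
          have h₁ := mul_le_mul_of_nonneg_left hxr hε0
          have h₂ := mul_le_mul_of_nonneg_right hε1 (norm_nonneg (x r - x 0 - r • v 0))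
          linarith [hg r]
        rw [one_mul, Prod.norm_mk, Prod.norm_mk]
        exact max_le ((le_max_right _ _).trans (le_add_of_nonneg_right hB0))
          (hgr.trans (by gcongr; exact le_max_left _ _))) r hr
    rw [gronwallBound_of_K_ne_0 one_ne_zero] at hgron
    have hexp : Real.exp r ≤ Real.exp T := Real.exp_le_exp.2 hr.2
    refine (norm_snd_le (x r - x 0 - r • v 0, v r - v 0)).trans (hgron.trans ?_)
    simp only [zero_mul, zero_add, div_one, one_mul, sub_zero]
    gcongr
    linarith
  simpa using norm_image_sub_le_of_norm_deriv_le_segment'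
    (fun r _ => (hz r).hasDerivWithinAt) (fun r hr => hspeed r (Set.Ico_subset_Icc_self hr)) u hu

/-- Run backwards from time `t₀`, a trajectory in a potential whose force grows at most linearly
deviates from uniform motion by a controlled amount. -/
theorem IsHamiltonSol.norm_sub_uniform_motion_le {V : ℝ × Euc n → ℝ} {X Ξ : ℝ → Euc n}
    (h : IsHamiltonSol V X Ξ) {ε M t₀ s : ℝ} (hε0 : 0 ≤ ε) (hε1 : ε ≤ 1) (hM : 0 ≤ M)
    (hV : ∀ (t : ℝ) (x : Euc n), ‖gradV V t x‖ ≤ ε * ‖x‖ + M) (hs : s ∈ Set.Icc 0 t₀) :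
    ‖X s - X t₀ + (t₀ - s) • Ξ t₀‖ ≤
      (ε * (‖X t₀‖ + t₀ * ‖Ξ t₀‖) + M) * Real.exp t₀ * (t₀ - s) := by
  have hx : ∀ u, HasDerivAt (fun u => X (t₀ - u)) (-Ξ (t₀ - u)) u := fun u =>
    (h.1 (t₀ - u)).comp_const_sub t₀ u
  have hv : ∀ u, HasDerivAt (fun u => -Ξ (t₀ - u)) (-gradV V (t₀ - u) (X (t₀ - u))) u := fun u => by
    simpa using ((h.2 (t₀ - u)).comp_const_sub t₀ u).fun_neg
  have := _root_.norm_sub_uniform_motion_le hx hv hε0 hε1 hM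
    (fun u => by rw [norm_neg]; exact hV _ _) (u := t₀ - s) (T := t₀)
    ⟨by linarith [hs.2], by linarith [hs.1]⟩
  simpa [sub_neg_eq_add] using this

/-- For a sub-quadratic potential, the Hamiltonian trajectory with data
`x(t₀) = x`, `ẋ(t₀) = λξ` satisfies `(1/(2a)) (t₀ - s) λ ≤ |x(s)| ≤ 2a (t₀ - s) λ`
for `λ` large, `x ∈ K`, `a⁻¹ ≤ |ξ| ≤ a`, `s ∈ [0, t₀]` with `t₀ - s ≥ λ^{p-1}`. -/
theorem hamilton_flow_position_estimate (hn : 1 ≤ n) (V : ℝ × Euc n → ℝ) (ρ : ℝ)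
    (hρ0 : 0 ≤ ρ) (hρ2 : ρ < 2) (hV : SubQuadratic ρ V)
    (K : Set (Euc n)) (hK : IsCompact K) (a : ℝ) (ha : 1 ≤ a)
    (t₀ : ℝ) (ht₀ : 0 < t₀) (p : ℝ) (hp0 : 0 < p) (hp1 : p < 1) :
    ∃ lam₀ : ℝ, 1 ≤ lam₀ ∧
      ∀ lam : ℝ, lam₀ ≤ lam → ∀ x ∈ K, ∀ ξ : Euc n, a⁻¹ ≤ ‖ξ‖ → ‖ξ‖ ≤ a →
        ∀ s ∈ Set.Icc (0 : ℝ) t₀, lam ^ (p - 1) ≤ t₀ - s →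
          ∀ X Ξ : ℝ → Euc n, IsHamiltonSol V X Ξ → X t₀ = x → Ξ t₀ = lam • ξ →
            (1 / (2 * a)) * (t₀ - s) * lam ≤ ‖X s‖ ∧ ‖X s‖ ≤ 2 * a * (t₀ - s) * lam := by
  have ha0 : 0 < a := by linarith
  obtain ⟨R, hR⟩ := hK.isBounded.exists_norm_le
  set ε : ℝ := min 1 (1 / (8 * a * (t₀ * a * Real.exp t₀)))
  have hε0 : 0 < ε := lt_min one_pos (by positivity)
  have hε1 : ε ≤ 1 := min_le_left _ _
  have hεa : ε * (t₀ * a) * Real.exp t₀ ≤ 1 / (8 * a) := by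
    calc ε * (t₀ * a) * Real.exp t₀
        ≤ 1 / (8 * a * (t₀ * a * Real.exp t₀)) * (t₀ * a) * Real.exp t₀ := by
          gcongr
          exact min_le_right _ _
      _ = 1 / (8 * a) := by field_simp
  obtain ⟨M, hM, hgrad⟩ := hV.exists_norm_gradV_le hρ2 hε0
  obtain ⟨L, hL⟩ := Filter.eventually_atTop.1
    ((tendsto_rpow_atTop hp0).eventually_ge_atTop (4 * a * R))
  refine ⟨max 1 (max L (8 * a * ((ε * R + M) * Real.exp t₀))), le_max_left _ _, ?_⟩
  intro lam hlam x hx ξ hξ1 hξ2 s hs hsp X Ξ hsol hX hΞ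
  have hlam1 : 1 ≤ lam := (le_max_left _ _).trans hlam
  have hlamL : 4 * a * R ≤ lam ^ p :=
    hL lam ((le_max_left _ _).trans ((le_max_right _ _).trans hlam))
  have hlamM : 8 * a * ((ε * R + M) * Real.exp t₀) ≤ lam :=
    (le_max_right _ _).trans ((le_max_right _ _).trans hlam)
  have hlam0 : 0 < lam := by linarith
  set u : ℝ := t₀ - s with hu
  have hu0 : 0 ≤ u := by linarith [hs.2]
  have hlamu : lam ^ p ≤ u * lam := by
    calc lam ^ p = lam ^ (p - 1) * lam := by
          rw [← Real.rpow_add_one hlam0.ne', sub_add_cancel]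
      _ ≤ u * lam := by gcongr
  have hxle : ‖x‖ ≤ u * lam / (4 * a) := by
    rw [le_div_iff₀ (by positivity)]
    nlinarith [hR x hx]
  have hdev := hsol.norm_sub_uniform_motion_le hε0.le hε1 hM hgrad hs
  rw [hX, hΞ, norm_smul, Real.norm_of_nonneg hlam0.le, ← hu] at hdev
  have hcoef : (ε * (‖x‖ + t₀ * (lam * ‖ξ‖)) + M) * Real.exp t₀ ≤ lam / (4 * a) := by
    have h₁ : (ε * R + M) * Real.exp t₀ ≤ lam / (8 * a) := by
      rw [le_div_iff₀ (by positivity)]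
      linarith
    have h₂ := mul_le_mul_of_nonneg_left hεa hlam0.le
    calc (ε * (‖x‖ + t₀ * (lam * ‖ξ‖)) + M) * Real.exp t₀
        ≤ (ε * (R + t₀ * (lam * a)) + M) * Real.exp t₀ := by
          gcongr
          exact hR x hx
      _ = (ε * R + M) * Real.exp t₀ + lam * (ε * (t₀ * a) * Real.exp t₀) := by ring
      _ ≤ lam / (8 * a) + lam * (1 / (8 * a)) := add_le_add h₁ h₂
      _ = lam / (4 * a) := by field_simp; norm_num
  have herr : ‖X s + u • lam • ξ‖ ≤ u * lam / (2 * a) := by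
    calc ‖X s + u • lam • ξ‖ = ‖(X s - x + u • lam • ξ) + x‖ := by congr 1; abel
      _ ≤ lam / (4 * a) * u + u * lam / (4 * a) :=
        (norm_add_le _ _).trans
          (add_le_add (hdev.trans (mul_le_mul_of_nonneg_right hcoef hu0)) hxle)
      _ = u * lam / (2 * a) := by field_simp; ring
  have hmain : ‖u • lam • ξ‖ = u * lam * ‖ξ‖ := by
    rw [norm_smul, norm_smul, Real.norm_of_nonneg hu0, Real.norm_of_nonneg hlam0.le, mul_assoc]
  have hul : 0 ≤ u * lam := by positivity
  constructor
  · have h₁ : ‖u • lam • ξ‖ ≤ ‖X s + u • lam • ξ‖ + ‖X s‖ := by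
      simpa using norm_sub_le (X s + u • lam • ξ) (X s)
    have h₂ : u * lam * a⁻¹ ≤ u * lam * ‖ξ‖ := by gcongr
    have h₃ : 1 / (2 * a) * u * lam = u * lam * a⁻¹ - u * lam / (2 * a) := by
      field_simp
      norm_num
    linarith
  · have h₁ : ‖X s‖ ≤ ‖X s + u • lam • ξ‖ + ‖u • lam • ξ‖ := by
      simpa using norm_sub_le (X s + u • lam • ξ) (u • lam • ξ)
    have h₂ : u * lam * ‖ξ‖ ≤ u * lam * a := by gcongr
    have h₃ : u * lam / (2 * a) ≤ u * lam * a := by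
      rw [div_le_iff₀ (by positivity)]
      nlinarith [mul_le_mul_of_nonneg_left (show (1 : ℝ) ≤ a * (2 * a) by nlinarith) hul]
    linarith

end
end

section
/- Let n ≥ 1, M ∈ ℕ, and let α be a multi-index. Then for every ψ ∈ 𝒮(ℝⁿ), every t ∈ ℝ and every x ∈ ℝⁿ: (1 + |x|²)^M ∂_x^α (U₀(t)ψ)(x) = U₀(t)[ (I + Σ_{j=1}^{n} A_j²)^M ∂^α ψ ](x), where A_j is the operator on 𝒮(ℝⁿ) given by (A_j g)(y) = y_j g(y) − i t ∂_{y_j} g(y), the A_j pairwise commute, and (I + Σ_j A_j²)^M denotes the M-fold composition of the operator I + Σ_j A_j². -/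
open MeasureTheory Complex
open scoped InnerProductSpace BigOperators

noncomputable section

variable {n : ℕ}

/-- The operator `A_j g = y_j g - i t ∂_{y_j} g`. -/
def Aop (t : ℝ) (j : Fin n) (g : Euc n → ℂ) : Euc n → ℂ :=
  fun y => ((y j : ℝ) : ℂ) * g y
    - Complex.I * (t : ℂ) * fderiv ℝ g y (EuclideanSpace.single j 1)

/-- The operator `I + ∑_j A_j²`. -/
def Bop (t : ℝ) (g : Euc n → ℂ) : Euc n → ℂ :=
  fun y => g y + ∑ j : Fin n, Aop t j (Aop t j g) y

section SchwartzOperators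

open SchwartzMap FourierTransform LineDeriv Function

lemma iteratedDeriv_cexp_I_mul_ofReal (m : ℕ) :
    iteratedDeriv m (fun s : ℝ => cexp (I * s)) = fun s : ℝ => I ^ m * cexp (I * s) := by
  induction m with
  | zero => simp
  | succ m ih =>
    rw [iteratedDeriv_succ, ih]
    funext s
    have h : HasDerivAt (fun s : ℝ => I * (s : ℂ)) (I * 1) s :=
      (Complex.ofRealCLM.hasDerivAt (x := s)).const_mul I
    rw [(h.cexp.const_mul (I ^ m)).deriv]
    ring

lemma hasTemperateGrowth_cexp_I_mul_ofReal :
    HasTemperateGrowth (fun s : ℝ => cexp (I * s)) := by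
  refine ⟨(contDiff_const.mul Complex.ofRealCLM.contDiff).cexp, fun m => ⟨0, 1, fun s => ?_⟩⟩
  rw [norm_iteratedFDeriv_eq_norm_iteratedDeriv, iteratedDeriv_cexp_I_mul_ofReal]
  simp [mul_comm I, Complex.norm_exp_ofReal_mul_I]

/-- The multiplier `e^{-it|ξ|²/2}` of the free Schrödinger evolution. -/
def schrodingerSymbol (t : ℝ) (ξ : Euc n) : ℂ := cexp (I * ((-t / 2 * ‖ξ‖ ^ 2 : ℝ) : ℂ))

lemma hasTemperateGrowth_schrodingerSymbol (t : ℝ) :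
    HasTemperateGrowth (schrodingerSymbol (n := n) t) := by
  have h : HasTemperateGrowth (fun ξ : Euc n => -t / 2 * ‖ξ‖ ^ 2) :=
    (HasTemperateGrowth.const (-t / 2)).mul (hasTemperateGrowth_norm_sq (Euc n))
  exact hasTemperateGrowth_cexp_I_mul_ofReal.comp h

lemma fderiv_schrodingerSymbol_single (t : ℝ) (ξ : Euc n) (j : Fin n) :
    fderiv ℝ (schrodingerSymbol t) ξ (EuclideanSpace.single j 1) =
      -I * t * (ξ j : ℂ) * schrodingerSymbol t ξ := by
  have h : HasFDerivAt (fun ξ : Euc n => I * ((-t / 2 * ‖ξ‖ ^ 2 : ℝ) : ℂ)) _ ξ :=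
    (Complex.ofRealCLM.hasFDerivAt.comp ξ
      (((hasStrictFDerivAt_norm_sq ξ).hasFDerivAt).const_mul (-t / 2))).const_mul I
  have h' := h.cexp
  unfold schrodingerSymbol
  rw [h'.fderiv]
  simp [EuclideanSpace.inner_single_right]
  ring

lemma hasTemperateGrowth_coord (j : Fin n) : HasTemperateGrowth (fun y : Euc n => (y j : ℂ)) :=
  (Complex.ofRealCLM.comp (EuclideanSpace.proj j : Euc n →L[ℝ] ℝ)).hasTemperateGrowth

/-- Multiplication by the `j`-th coordinate on Schwartz space. -/
def coordMul (j : Fin n) : 𝓢(Euc n, ℂ) →L[ℂ] 𝓢(Euc n, ℂ) :=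
  smulLeftCLM ℂ (fun y : Euc n => (y j : ℂ))

@[simp]
lemma coordMul_apply (j : Fin n) (g : 𝓢(Euc n, ℂ)) (y : Euc n) :
    coordMul j g y = (y j : ℂ) * g y := by
  simp [coordMul, hasTemperateGrowth_coord]

/-- The partial derivative `∂_j` on Schwartz space. -/
def coordDeriv (j : Fin n) : 𝓢(Euc n, ℂ) →L[ℂ] 𝓢(Euc n, ℂ) :=
  lineDerivOpCLM ℂ 𝓢(Euc n, ℂ) (EuclideanSpace.single j (1 : ℝ))

lemma coordDeriv_apply (j : Fin n) (g : 𝓢(Euc n, ℂ)) (y : Euc n) :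
    coordDeriv j g y = fderiv ℝ g y (EuclideanSpace.single j 1) := rfl

/-- Dilation by a nonzero real `c` on Schwartz space. -/
def scale (c : ℝ) (hc : c ≠ 0) : 𝓢(Euc n, ℂ) →L[ℂ] 𝓢(Euc n, ℂ) :=
  compCLMOfContinuousLinearEquiv ℂ (ContinuousLinearEquiv.smulLeft (Units.mk0 c hc))

@[simp]
lemma scale_apply (c : ℝ) (hc : c ≠ 0) (g : 𝓢(Euc n, ℂ)) (y : Euc n) :
    scale c hc g y = g (c • y) := rfl

lemma coordDeriv_scale (c : ℝ) (hc : c ≠ 0) (j : Fin n) (g : 𝓢(Euc n, ℂ)) (y : Euc n) :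
    coordDeriv j (scale c hc g) y = c * coordDeriv j g (c • y) := by
  have h := fderiv_comp_smul (𝕜 := ℝ) (f := g) (x := y) c
  simp only [coordDeriv_apply]
  change fderiv ℝ (fun y => g (c • y)) y _ = _
  rw [h]
  simp

/-- The Fourier transform `f̂(ξ) = ∫ e^{-i y·ξ} f y dy` on Schwartz space. -/
def schwartzFT : 𝓢(Euc n, ℂ) →L[ℂ] 𝓢(Euc n, ℂ) :=
  (scale (2 * Real.pi)⁻¹ (by positivity)).comp (fourierTransformCLM ℂ)

lemma schwartzFT_apply_fourier (g : 𝓢(Euc n, ℂ)) (ξ : Euc n) :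
    schwartzFT g ξ = 𝓕 g ((2 * Real.pi)⁻¹ • ξ) := rfl

lemma schwartzFT_apply (g : 𝓢(Euc n, ℂ)) (ξ : Euc n) : schwartzFT g ξ = FT g ξ := by
  rw [schwartzFT_apply_fourier, fourier_coe, Real.fourier_eq', FT]
  congr 1
  funext y
  rw [smul_eq_mul]
  congr 2
  rw [inner_smul_right]
  have : (Real.pi : ℂ) ≠ 0 := by exact_mod_cast Real.pi_ne_zero
  push_cast
  field_simp

lemma smulLeftCLM_inner_single (j : Fin n) (g : 𝓢(Euc n, ℂ)) :
    smulLeftCLM ℂ (fun y : Euc n => ⟪y, EuclideanSpace.single j (1 : ℝ)⟫_ℝ) g =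
      coordMul j g := by
  ext y
  rw [smulLeftCLM_apply_apply (by fun_prop)]
  simp [EuclideanSpace.inner_single_right]

lemma schwartzFT_coordDeriv (j : Fin n) (g : 𝓢(Euc n, ℂ)) (ξ : Euc n) :
    schwartzFT (coordDeriv j g) ξ = I * ξ j * schwartzFT g ξ := by
  have h : 𝓕 (coordDeriv j g) = (2 * Real.pi * I) • coordMul j (𝓕 g) :=
    (fourier_lineDerivOp_eq g _).trans (by rw [smulLeftCLM_inner_single])
  have hpi : (Real.pi : ℂ) ≠ 0 := by exact_mod_cast Real.pi_ne_zero
  simp only [schwartzFT_apply_fourier, h, smul_apply, coordMul_apply, PiLp.smul_apply, smul_eq_mul]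
  push_cast
  field_simp

lemma coordDeriv_schwartzFT (j : Fin n) (g : 𝓢(Euc n, ℂ)) :
    coordDeriv j (schwartzFT g) = -I • schwartzFT (coordMul j g) := by
  have h : coordDeriv j (fourierTransformCLM ℂ g) =
      fourierTransformCLM ℂ (-(2 * Real.pi * I) • coordMul j g) :=
    (lineDerivOp_fourier_eq g _).trans (by rw [smulLeftCLM_inner_single]; rfl)
  have hpi : (Real.pi : ℂ) ≠ 0 := by exact_mod_cast Real.pi_ne_zero
  ext ξ
  simp only [schwartzFT, ContinuousLinearMap.comp_apply, coordDeriv_scale, h, map_smul,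
    smul_apply, scale_apply, smul_eq_mul]
  push_cast
  field_simp

/-- The operator `A_j` on Schwartz space. -/
def schwartzAop (t : ℝ) (j : Fin n) : 𝓢(Euc n, ℂ) →L[ℂ] 𝓢(Euc n, ℂ) :=
  coordMul j - (I * t) • coordDeriv j

lemma coe_schwartzAop (t : ℝ) (j : Fin n) (g : 𝓢(Euc n, ℂ)) :
    ⇑(schwartzAop t j g) = Aop t j g := by
  funext y
  simp [schwartzAop, Aop, coordDeriv_apply]

/-- The operator `I + ∑_j A_j²` on Schwartz space. -/
def schwartzBop (t : ℝ) : 𝓢(Euc n, ℂ) →L[ℂ] 𝓢(Euc n, ℂ) :=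
  .id ℂ _ + ∑ j, (schwartzAop t j).comp (schwartzAop t j)

lemma coe_schwartzBop (t : ℝ) (g : 𝓢(Euc n, ℂ)) : ⇑(schwartzBop t g) = Bop t g := by
  funext y
  simp [schwartzBop, Bop, ← coe_schwartzAop]

/-- Multiplication by the Schrödinger multiplier on Schwartz space. -/
def symbolMul (t : ℝ) : 𝓢(Euc n, ℂ) →L[ℂ] 𝓢(Euc n, ℂ) := smulLeftCLM ℂ (schrodingerSymbol t)

@[simp]
lemma symbolMul_apply (t : ℝ) (g : 𝓢(Euc n, ℂ)) (y : Euc n) :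
    symbolMul t g y = schrodingerSymbol t y * g y := by
  simp [symbolMul, hasTemperateGrowth_schrodingerSymbol]

lemma coordMul_symbolMul (t : ℝ) (j : Fin n) (g : 𝓢(Euc n, ℂ)) :
    coordMul j (symbolMul t g) = symbolMul t (coordMul j g) := by
  ext y
  simp
  ring

lemma coordDeriv_symbolMul (t : ℝ) (j : Fin n) (g : 𝓢(Euc n, ℂ)) :
    coordDeriv j (symbolMul t g) =
      symbolMul t (coordDeriv j g - (I * t) • coordMul j g) := by
  ext y
  have h : ⇑(symbolMul t g) = fun y => schrodingerSymbol t y * g y :=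
    funext (symbolMul_apply t g)
  rw [coordDeriv_apply, h, fderiv_fun_mul
    ((hasTemperateGrowth_schrodingerSymbol t).1.differentiable (by simp) y) g.differentiableAt]
  simp [fderiv_schrodingerSymbol_single, coordDeriv_apply]
  ring

/-- The free Schrödinger evolution on Schwartz space. -/
def schwartzU0 (t : ℝ) : 𝓢(Euc n, ℂ) →L[ℂ] 𝓢(Euc n, ℂ) :=
  ((((2 * Real.pi) ^ n)⁻¹ : ℝ) : ℂ) •
    (scale (-1) (by norm_num)).comp (schwartzFT.comp ((symbolMul t).comp schwartzFT))

lemma coe_schwartzU0 (t : ℝ) (g : 𝓢(Euc n, ℂ)) : ⇑(schwartzU0 t g) = U0 t g := by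
  funext x
  simp only [schwartzU0, U0, smul_apply,
    ContinuousLinearMap.comp_apply, scale_apply, Complex.coe_smul]
  rw [schwartzFT_apply, FT]
  congr 2
  funext ξ
  rw [symbolMul_apply, schwartzFT_apply, ← mul_assoc, schrodingerSymbol, ← Complex.exp_add]
  congr 2
  rw [real_inner_comm]
  simp
  ring

lemma coordDeriv_schwartzU0 (t : ℝ) (j : Fin n) (g : 𝓢(Euc n, ℂ)) :
    coordDeriv j (schwartzU0 t g) = schwartzU0 t (coordDeriv j g) := by
  have h : schwartzFT (coordDeriv j g) = I • coordMul j (schwartzFT g) := by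
    ext ξ
    simp [schwartzFT_coordDeriv, mul_assoc]
  ext x
  simp only [schwartzU0, smul_apply,
    ContinuousLinearMap.comp_apply, map_smul, coordDeriv_scale, coordDeriv_schwartzFT, h,
    coordMul_symbolMul, scale_apply]
  simp

lemma schwartzU0_schwartzAop (t : ℝ) (j : Fin n) (g : 𝓢(Euc n, ℂ)) (x : Euc n) :
    schwartzU0 t (schwartzAop t j g) x = x j * schwartzU0 t g x := by
  have h : symbolMul t (schwartzFT (schwartzAop t j g)) =
      I • coordDeriv j (symbolMul t (schwartzFT g)) := by
    rw [coordDeriv_symbolMul, coordDeriv_schwartzFT]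
    ext ξ
    simp [schwartzAop, schwartzFT_coordDeriv]
    ring_nf
    simp
  simp only [schwartzU0, smul_apply,
    ContinuousLinearMap.comp_apply, h, map_smul, scale_apply, schwartzFT_coordDeriv]
  simp
  ring_nf
  simp

lemma schwartzU0_schwartzBop (t : ℝ) (g : 𝓢(Euc n, ℂ)) (x : Euc n) :
    schwartzU0 t (schwartzBop t g) x = ((1 + ‖x‖ ^ 2 : ℝ) : ℂ) * schwartzU0 t g x := by
  simp only [schwartzBop, add_apply, sum_apply,
    ContinuousLinearMap.comp_apply, ContinuousLinearMap.id_apply, map_add, map_sum,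
    schwartzU0_schwartzAop,
    EuclideanSpace.real_norm_sq_eq]
  push_cast
  rw [add_mul, one_mul, Finset.sum_mul]
  simp only [sq, mul_assoc]

lemma coe_schwartzBop_iterate (t : ℝ) (M : ℕ) (g : 𝓢(Euc n, ℂ)) :
    ⇑((schwartzBop t)^[M] g) = (Bop t)^[M] g := by
  induction M with
  | zero => rfl
  | succ M ih => rw [iterate_succ_apply', iterate_succ_apply', coe_schwartzBop, ih]

lemma schwartzU0_schwartzBop_iterate (t : ℝ) (M : ℕ) (g : 𝓢(Euc n, ℂ)) (x : Euc n) :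
    schwartzU0 t ((schwartzBop t)^[M] g) x =
      (((1 + ‖x‖ ^ 2) ^ M : ℝ) : ℂ) * schwartzU0 t g x := by
  induction M with
  | zero => simp
  | succ M ih =>
    rw [iterate_succ_apply', schwartzU0_schwartzBop, ih]
    push_cast
    ring

lemma exists_coe_eq_multiPartial (α : Fin n → ℕ) (g : 𝓢(Euc n, ℂ)) (t : ℝ) :
    ∃ h : 𝓢(Euc n, ℂ), ⇑h = multiPartial α g ∧
      ⇑(schwartzU0 t h) = multiPartial α (schwartzU0 t g) := by
  have hiter (j : Fin n) (m : ℕ) (f : 𝓢(Euc n, ℂ)) :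
      ⇑((coordDeriv j)^[m] f) = (partialD j)^[m] f := by
    induction m with
    | zero => rfl
    | succ m ih => rw [iterate_succ_apply', iterate_succ_apply', ← ih]; rfl
  have hcomm (j : Fin n) (m : ℕ) (f : 𝓢(Euc n, ℂ)) :
      schwartzU0 t ((coordDeriv j)^[m] f) = (coordDeriv j)^[m] (schwartzU0 t f) :=
    (show Semiconj (schwartzU0 t) (coordDeriv j) (coordDeriv j) from
      fun f => (coordDeriv_schwartzU0 t j f).symm).iterate_right m f
  unfold multiPartial
  rw [List.ofFn_eq_map]
  induction List.finRange n with
  | nil => exact ⟨g, rfl, rfl⟩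
  | cons j l ih =>
    obtain ⟨h, h₁, h₂⟩ := ih
    refine ⟨(coordDeriv j)^[α j] h, ?_, ?_⟩
    · rw [hiter, h₁]; rfl
    · rw [hcomm, hiter, h₂]; rfl

lemma coordDeriv_comm (j k : Fin n) (g : 𝓢(Euc n, ℂ)) :
    coordDeriv j (coordDeriv k g) = coordDeriv k (coordDeriv j g) := by
  have key (j k : Fin n) (y : Euc n) : coordDeriv j (coordDeriv k g) y =
      fderiv ℝ (fderiv ℝ g) y (EuclideanSpace.single j 1) (EuclideanSpace.single k 1) := by
    have hd : DifferentiableAt ℝ (fderiv ℝ g) y := (fderivCLM ℝ (Euc n) ℂ g).differentiableAt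
    have h : ⇑(coordDeriv k g) = fun y => fderiv ℝ g y (EuclideanSpace.single k 1) := rfl
    rw [coordDeriv_apply, h, fderiv_clm_apply hd (by fun_prop)]
    simp
  ext y
  rw [key, key]
  exact ((g.smooth 2).contDiffAt.isSymmSndFDerivAt (by simp)) _ _

lemma coordDeriv_coordMul (j k : Fin n) (g : 𝓢(Euc n, ℂ)) :
    coordDeriv j (coordMul k g) = (if j = k then (1 : ℂ) else 0) • g +
      coordMul k (coordDeriv j g) := by
  ext y
  have h : ⇑(coordMul k g) = fun y => (y k : ℂ) * g y := funext (coordMul_apply k g)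
  have hk : HasFDerivAt (fun y : Euc n => (y k : ℂ))
      (Complex.ofRealCLM.comp (EuclideanSpace.proj k : Euc n →L[ℝ] ℝ)) y :=
    (Complex.ofRealCLM.comp (EuclideanSpace.proj k : Euc n →L[ℝ] ℝ)).hasFDerivAt
  rw [coordDeriv_apply, h, fderiv_fun_mul hk.differentiableAt g.differentiableAt, hk.fderiv]
  by_cases hjk : j = k <;> simp [coordDeriv_apply, hjk, eq_comm, add_comm]

lemma schwartzAop_comm (t : ℝ) (j k : Fin n) (g : 𝓢(Euc n, ℂ)) :
    schwartzAop t j (schwartzAop t k g) = schwartzAop t k (schwartzAop t j g) := by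
  simp only [schwartzAop, sub_apply, smul_apply, map_sub,
    map_smul, coordDeriv_coordMul, coordDeriv_comm j k, eq_comm (a := k) (b := j)]
  ext y
  simp
  ring

end SchwartzOperators

/-- `(1 + |x|²)^M ∂_x^α (U₀(t)ψ)(x) = U₀(t)[(I + ∑_j A_j²)^M ∂^α ψ](x)`,
where the `A_j` pairwise commute on Schwartz functions. -/
theorem U0_weight_derivative_formula (hn : 1 ≤ n) (M : ℕ) (α : Fin n → ℕ) :
    (∀ (t : ℝ) (j k : Fin n) (g : SchwartzMap (Euc n) ℂ),
        Aop t j (Aop t k ⇑g) = Aop t k (Aop t j ⇑g)) ∧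
      ∀ (ψ : SchwartzMap (Euc n) ℂ) (t : ℝ) (x : Euc n),
        (((1 + ‖x‖ ^ 2) ^ M : ℝ) : ℂ) * multiPartial α (U0 t ⇑ψ) x =
          U0 t ((Bop t)^[M] (multiPartial α ⇑ψ)) x := by
  refine ⟨fun t j k g => ?_, fun ψ t x => ?_⟩
  · simp only [← coe_schwartzAop, schwartzAop_comm t j k]
  · obtain ⟨h, h₁, h₂⟩ := exists_coe_eq_multiPartial α ψ t
    rw [← coe_schwartzU0, ← h₁, ← h₂, ← coe_schwartzBop_iterate, ← coe_schwartzU0,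
      schwartzU0_schwartzBop_iterate]

end
end
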